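/- Let (Y_T)_{T≥1} be any sequence of arrival sequences, and suppose that for every pair of nonnegative integers (d,b) the long-run average c^π(d,b) := lim_{T→∞} c^{Y_1 ⊕ Y_2 ⊕ ⋯ ⊕ Y_T}(d,b) / T exists, where ⊕ denotes concatenation of arrival sequences. Then c^π is multimodular. -/

import Mathlib

/-- One step of the station dynamics. -/
def step (cap : ℕ) (b : ℕ) (x : ℤ) : ℕ :=
  (max 0 (min (cap : ℤ) ((b : ℤ) + x))).toNat

/-- Number of out-of-stock events for arrival list `X`, capacity `cap`, starting bikes `b`. -/
def cost (cap : ℕ) : ℕ → List ℤ → ℕ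
  | _, [] => 0
  | b, x :: xs => (if step cap b x = b then 1 else 0) + cost cap (step cap b x) xs

/-- The user dissatisfaction function `c^X(d,b)`. -/
def udf (X : List ℤ) (d b : ℕ) : ℕ := cost (d + b) b X

/-- Multimodularity of `f : ℕ² → ℝ`. -/
def Multimodular (f : ℕ → ℕ → ℝ) : Prop :=
  (∀ d b : ℕ, f (d+1) (b+1) - f (d+1) b ≥ f d (b+1) - f d b) ∧
  (∀ d b : ℕ, f d (b+2) - f d (b+1) ≥ f (d+1) (b+1) - f (d+1) b) ∧
  (∀ d b : ℕ, f (d+2) b - f (d+1) b ≥ f (d+1) (b+1) - f d (b+1))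

/-- Concatenation `Y_1 ⊕ Y_2 ⊕ ⋯ ⊕ Y_T` of the first `T` arrival sequences. -/
def concatUpTo (Y : ℕ → List ℤ) (T : ℕ) : List ℤ := (List.range T).flatMap Y

lemma udf_nil (d b : ℕ) : udf [] d b = 0 := rfl

lemma udf_ret_zero (X : List ℤ) (b : ℕ) : udf (1 :: X) 0 b = 1 + udf X 0 b := by
  have h : step (0 + b) b 1 = b := by unfold step; omega
  simp only [udf, cost, h, if_true]

lemma udf_ret_succ (X : List ℤ) (d b : ℕ) : udf (1 :: X) (d+1) b = udf X d (b+1) := by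
  have h : step (d + 1 + b) b 1 = b + 1 := by unfold step; omega
  have e : d + 1 + b = d + (b + 1) := by omega
  simp only [udf, cost, h]
  simp [e]

lemma udf_rent_zero (X : List ℤ) (d : ℕ) : udf (-1 :: X) d 0 = 1 + udf X d 0 := by
  have h : step (d + 0) 0 (-1) = 0 := by unfold step; omega
  simp only [udf, cost, h, if_true]

lemma udf_rent_succ (X : List ℤ) (d b : ℕ) : udf (-1 :: X) d (b+1) = udf X (d+1) b := by
  have h : step (d + (b + 1)) (b + 1) (-1) = b := by unfold step; omega
  have e : d + 1 + b = d + (b + 1) := by omega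
  simp only [udf, cost, h]
  simp [e]

/-- Multimodularity of the user dissatisfaction function (in subtraction-free form), together
with the fact that moving one unit changes the cost by at most one. -/
lemma udf_props (X : List ℤ) (hX : ∀ x ∈ X, x = 1 ∨ x = -1) :
    (∀ d b, udf X (d+1) (b+1) + udf X d b ≥ udf X d (b+1) + udf X (d+1) b) ∧
    (∀ d b, udf X d (b+2) + udf X (d+1) b ≥ udf X (d+1) (b+1) + udf X d (b+1)) ∧
    (∀ d b, udf X (d+2) b + udf X d (b+1) ≥ udf X (d+1) (b+1) + udf X (d+1) b) ∧
    (∀ d b, udf X (d+1) b ≤ udf X d (b+1) + 1 ∧ udf X d (b+1) ≤ udf X (d+1) b + 1) := by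
  induction X with
  | nil => simp [udf_nil]
  | cons x X ih =>
    obtain ⟨h1, h2, h3, h4⟩ := ih (fun y hy => hX y (List.mem_cons_of_mem _ hy))
    rcases hX x List.mem_cons_self with rfl | rfl
    · refine ⟨?_, ?_, ?_, ?_⟩ <;> intro d b <;> rcases d with _ | d <;>
        simp only [udf_ret_zero, udf_ret_succ, Nat.zero_add]
      · have a := h1 0 b; have c := h2 0 b
        simp only [Nat.zero_add] at a c
        (simp only [Nat.add_assoc, Nat.reduceAdd] at *; omega)
      · exact h1 d (b+1)
      · (simp only [Nat.add_assoc, Nat.reduceAdd] at *; omega)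
      · exact h2 d (b+1)
      · have a := h4 0 (b+1)
        simp only [Nat.zero_add] at a
        change udf X 1 (b+1) + _ ≥ _
        omega
      · exact h3 d (b+1)
      · omega
      · exact h4 d (b+1)
    · refine ⟨?_, ?_, ?_, ?_⟩ <;> intro d b <;> rcases b with _ | b <;>
        simp only [udf_rent_zero, udf_rent_succ, Nat.zero_add]
      · have a := h1 d 0; have c := h3 d 0
        simp only [Nat.zero_add] at a c
        change udf X (d+2) 0 + _ ≥ _
        omega
      · have a := h1 (d+1) b
        omega
      · have a := h4 (d+1) 0
        simp only [Nat.zero_add] at a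
        change udf X (d+1) 1 + _ ≥ udf X (d+2) 0 + _
        (simp only [Nat.add_assoc, Nat.reduceAdd] at *; omega)
      · exact h2 (d+1) b
      · change _ ≥ udf X (d+2) 0 + _
        omega
      · exact h3 (d+1) b
      · omega
      · exact h4 (d+1) b

/-- If, for a sequence `(Y_T)` of arrival sequences, the long-run average
`c^π(d,b) = lim_{T→∞} c^{Y_1 ⊕ ⋯ ⊕ Y_T}(d,b)/T` exists for every `(d,b)`, then
`c^π` is multimodular. -/
theorem long_run_average_multimodular (Y : ℕ → List ℤ)
    (hY : ∀ T, ∀ x ∈ Y T, x = 1 ∨ x = -1)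
    (cpi : ℕ → ℕ → ℝ)
    (hlim : ∀ d b : ℕ, Filter.Tendsto
      (fun T : ℕ => (udf (concatUpTo Y T) d b : ℝ) / T)
      Filter.atTop (nhds (cpi d b))) :
    Multimodular cpi := by
  have hX : ∀ T, ∀ x ∈ concatUpTo Y T, x = 1 ∨ x = -1 := by
    intro T x hx
    obtain ⟨t, _, ht⟩ := List.mem_flatMap.1 hx
    exact hY t x ht
  have key : ∀ d₁ b₁ d₂ b₂ d₃ b₃ d₄ b₄ : ℕ,
      (∀ T, udf (concatUpTo Y T) d₁ b₁ + udf (concatUpTo Y T) d₂ b₂ ≥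
        udf (concatUpTo Y T) d₃ b₃ + udf (concatUpTo Y T) d₄ b₄) →
      cpi d₃ b₃ + cpi d₄ b₄ ≤ cpi d₁ b₁ + cpi d₂ b₂ := by
    intro d₁ b₁ d₂ b₂ d₃ b₃ d₄ b₄ h
    refine le_of_tendsto_of_tendsto' ((hlim d₃ b₃).add (hlim d₄ b₄))
      ((hlim d₁ b₁).add (hlim d₂ b₂)) (fun T => ?_)
    rw [← add_div, ← add_div]
    apply div_le_div_of_nonneg_right _ (Nat.cast_nonneg T)
    exact_mod_cast h T
  refine ⟨fun d b => ?_, fun d b => ?_, fun d b => ?_⟩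
  · have := key _ _ _ _ _ _ _ _ (fun T => (udf_props _ (hX T)).1 d b)
    linarith
  · have := key _ _ _ _ _ _ _ _ (fun T => (udf_props _ (hX T)).2.1 d b)
    linarith
  · have := key _ _ _ _ _ _ _ _ (fun T => (udf_props _ (hX T)).2.2.1 d b)
    linarith
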